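/- arXiv:2305.14170 — 2 statements merged into one kernel-verified Lean document; each statement's English description precedes it below -/
import Mathlib

section
/- (Theorem 1, eq. (2)) For all integers m ≥ 1, d ≥ 1, the generating functions G^{⟨s,t⟩}_{m,d}(x) satisfy the following system of identities of formal power series over ℤ: (i) G^{⟨0,0⟩}_{m,d}(x) = 1 + x^d Σ_{i=0}^{d} G^{⟨i,0⟩}_{m,d}(x); and (ii) for every 0 ≤ t ≤ d−1 and 0 < s ≤ d with t < s, G^{⟨s,t⟩}_{m,d}(x) = (−1)^t δ_{s,t} C_{m,d}(x) + Σ_{i=0}^{t−1} (−1)^{t−i+1} G^{⟨s−t+i,i⟩}_{m,d}(x) + x^d Σ_{a=1}^{d} [ (−1)^v δ_{s,a} C_{m,d}(x) + Σ_{j=0}^{v−1} (−1)^{v−j+1} G^{⟨u−v+j,j⟩}_{m,d}(x) ] · Σ_{c=0}^{d−a} G^{⟨c,t⟩}_{m,d}(x), where u = max(s,a), v = min(s,a), δ_{i,j} = 1 if i = j and 0 otherwise, and C_{m,d}(x) = Σ_{k=0}^{m−2} x^{dk}. -/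
/-- A step of a lattice path: up `(1,1)`, down `(1,-1)`, or horizontal `(1,0)`. -/
inductive DStep : Type
  | U : DStep
  | D : DStep
  | L : DStep
  deriving DecidableEq

/-- The vertical displacement of a step. -/
def DStep.val : DStep → ℤ
  | .U => 1
  | .D => -1
  | .L => 0

/-- Total vertical displacement of a word of steps. -/
def stepSum (w : List DStep) : ℤ := (w.map DStep.val).sum

/-- A word of the form `D^a L^b U^c` with `a + b + c = d`. -/
def IsPieceWord (d : ℕ) (p : List DStep) : Prop :=
  ∃ a b c : ℕ, a + b + c = d ∧
    p = List.replicate a DStep.D ++ List.replicate b DStep.L ++ List.replicate c DStep.U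

/-- `M` is a DLU path of length `d*n` from `(0,s)` to `(d*n,t)`:
each consecutive block (piece) of `d` steps has the form `D^a L^b U^c`,
the path starts at height `s`, ends at height `t`, and never passes below the x-axis. -/
def IsDLUPath (d n s t : ℕ) (M : List DStep) : Prop :=
  M.length = d * n ∧
  (∀ i < n, IsPieceWord d ((M.drop (d * i)).take d)) ∧
  (s : ℤ) + stepSum M = (t : ℤ) ∧
  ∀ k ≤ M.length, 0 ≤ (s : ℤ) + stepSum (M.take k)

/-- The completed path `M̂ = L^{d-s} U^s M D^t L^{d-t}`. -/
def hatPath (d s t : ℕ) (M : List DStep) : List DStep :=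
  List.replicate (d - s) DStep.L ++ List.replicate s DStep.U ++ M ++
    List.replicate t DStep.D ++ List.replicate (d - t) DStep.L

/-- `w` contains a contiguous subpath `U P D` with `P ∈ {∅, L^d, L^{2d}, …, L^{(m-2)d}}`. -/
def HasShortUD (m d : ℕ) (w : List DStep) : Prop :=
  ∃ k : ℕ, k + 2 ≤ m ∧
    ([DStep.U] ++ List.replicate (k * d) DStep.L ++ [DStep.D]) <:+: w

/-- `w` is `m`-regular: it contains no subpath `U P D` with
`P ∈ {∅, L^d, L^{2d}, …, L^{(m-2)d}}`. -/
def RegularWord (m d : ℕ) (w : List DStep) : Prop := ¬ HasShortUD m d w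

/-- `w` has pattern `Λ`: it contains a contiguous subpath `U U P D D` in which the two `U`'s
lie in a common piece (block of `d` steps), the two `D`'s lie in a common piece, and `P`
starts and ends at the same height `h` and never passes below height `h`. -/
def HasLambda (d : ℕ) (w : List DStep) : Prop :=
  ∃ pre P suf : List DStep,
    w = pre ++ [DStep.U, DStep.U] ++ P ++ [DStep.D, DStep.D] ++ suf ∧
    (pre.length + 1) % d ≠ 0 ∧
    (pre.length + P.length + 3) % d ≠ 0 ∧
    stepSum P = 0 ∧
    (∀ k ≤ P.length, 0 ≤ stepSum (P.take k))

/-- An `m`-regular `Λ`-avoiding DLU path of length `d*n` from `(0,s)` to `(d*n,t)`: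
the regularity and `Λ`-avoidance conditions are imposed on the completed path `M̂`. -/
def IsGoodPath (m d n s t : ℕ) (M : List DStep) : Prop :=
  IsDLUPath d n s t M ∧ RegularWord m d (hatPath d s t M) ∧ ¬ HasLambda d (hatPath d s t M)

/-- A prime path: an `m`-regular `Λ`-avoiding DLU path which never touches the x-axis. -/
def IsPrimePath (m d n s t : ℕ) (M : List DStep) : Prop :=
  IsGoodPath m d n s t M ∧ ∀ k ≤ M.length, 0 < (s : ℤ) + stepSum (M.take k)

/-- `g^{⟨s,t⟩}_{m,d}(dn)`: the number of `m`-regular `Λ`-avoiding DLU paths of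
length `d*n` from `(0,s)` to `(d*n,t)`. -/
noncomputable def gCount (m d n s t : ℕ) : ℕ := {M : List DStep | IsGoodPath m d n s t M}.ncard

/-- `a^{⟨s,t⟩}_{m,d}(dn)`: the number of prime `m`-regular `Λ`-avoiding DLU paths of
length `d*n` from `(0,s)` to `(d*n,t)`. -/
noncomputable def aCount (m d n s t : ℕ) : ℕ := {M : List DStep | IsPrimePath m d n s t M}.ncard

/-- The generating function `G^{⟨s,t⟩}_{m,d}(x) = Σ_{n≥0} g^{⟨s,t⟩}_{m,d}(dn) x^{dn}`. -/
noncomputable def Gps (m d s t : ℕ) : PowerSeries ℤ :=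
  PowerSeries.mk fun N => if d ∣ N then (gCount m d (N / d) s t : ℤ) else 0

/-- The generating function `A^{⟨s,t⟩}_{m,d}(x) = Σ_{n≥0} a^{⟨s,t⟩}_{m,d}(dn) x^{dn}`. -/
noncomputable def Aps (m d s t : ℕ) : PowerSeries ℤ :=
  PowerSeries.mk fun N => if d ∣ N then (aCount m d (N / d) s t : ℤ) else 0

/-- `C_{m,d}(x) = (x^{d(m-1)} - 1)/(x^d - 1) = Σ_{k=0}^{m-2} x^{dk}`. -/
noncomputable def Cps (m d : ℕ) : PowerSeries ℤ :=
  ∑ k ∈ Finset.range (m - 1), (PowerSeries.X : PowerSeries ℤ) ^ (d * k)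

/-- `S` is a `d`-contact stack on `[n]`: a set of arcs `(i,j)` with `1 ≤ i < j ≤ n`,
noncrossing, in which every vertex lies in at most `d` arcs. -/
def IsContactStack (d n : ℕ) (S : Finset (ℕ × ℕ)) : Prop :=
  (∀ p ∈ S, 1 ≤ p.1 ∧ p.1 < p.2 ∧ p.2 ≤ n) ∧
  (∀ p ∈ S, ∀ q ∈ S, ¬ (p.1 < q.1 ∧ q.1 < p.2 ∧ p.2 < q.2)) ∧
  (∀ v : ℕ, (S.filter fun p => p.1 = v ∨ p.2 = v).card ≤ d)

/-- Every arc of `S` has length at least `m`. -/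
def ArcsRegular (m : ℕ) (S : Finset (ℕ × ℕ)) : Prop := ∀ p ∈ S, m ≤ p.2 - p.1

/-- `S` is an `m`-regular `d`-contact stack on `[n]`. -/
def IsStack (m d n : ℕ) (S : Finset (ℕ × ℕ)) : Prop :=
  IsContactStack d n S ∧ ArcsRegular m S

/-- The left degree of vertex `v`: the number of arcs ending at `v`. -/
def ldeg (S : Finset (ℕ × ℕ)) (v : ℕ) : ℕ := (S.filter fun p => p.2 = v).card

/-- The right degree of vertex `v`: the number of arcs starting at `v`. -/
def rdeg (S : Finset (ℕ × ℕ)) (v : ℕ) : ℕ := (S.filter fun p => p.1 = v).card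

/-- The map `η`, sending a stack `S` on `[n]` to the word `P_1 P_2 ⋯ P_n` where
`P_v = D^{ldeg v} L^{d - ldeg v - rdeg v} U^{rdeg v}`. -/
def eta (d n : ℕ) (S : Finset (ℕ × ℕ)) : List DStep :=
  (List.range n).flatMap fun i =>
    List.replicate (ldeg S (i + 1)) DStep.D ++
      List.replicate (d - ldeg S (i + 1) - rdeg S (i + 1)) DStep.L ++
      List.replicate (rdeg S (i + 1)) DStep.U

/-- `s_{m,d}(n)`: the number of `m`-regular `d`-contact stacks on `[n]`. -/
noncomputable def sCount (m d n : ℕ) : ℕ := {S : Finset (ℕ × ℕ) | IsStack m d n S}.ncard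

/-- The generating function `S_{m,d}(x) = Σ_{n≥0} s_{m,d}(n) xⁿ`. -/
noncomputable def Sps (m d : ℕ) : PowerSeries ℤ := PowerSeries.mk fun n => (sCount m d n : ℤ)

namespace DLU

/-! ### Elementary facts on words -/

instance : Finite DStep := by
  refine Finite.of_surjective (fun i : Fin 3 => match i with
    | 0 => DStep.U | 1 => DStep.D | 2 => DStep.L) ?_
  intro x
  cases x
  · exact ⟨0, rfl⟩
  · exact ⟨1, rfl⟩
  · exact ⟨2, rfl⟩

@[simp] theorem ss_nil : stepSum [] = 0 := rfl

@[simp] theorem ss_append (X Y : List DStep) : stepSum (X ++ Y) = stepSum X + stepSum Y := by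
  simp [stepSum]

@[simp] theorem ss_cons (x : DStep) (Y : List DStep) : stepSum (x :: Y) = x.val + stepSum Y := by
  simp [stepSum]

@[simp] theorem ss_rep (k : ℕ) (x : DStep) : stepSum (List.replicate k x) = k * x.val := by
  simp [stepSum]

@[simp] theorem valU : DStep.val .U = 1 := rfl
@[simp] theorem valD : DStep.val .D = -1 := rfl
@[simp] theorem valL : DStep.val .L = 0 := rfl

/-- All heights of the word, started at height `h`, are nonnegative. -/
def NN (h : ℤ) (W : List DStep) : Prop := ∀ X Y, W = X ++ Y → 0 ≤ h + stepSum X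

theorem NN_iff_take (h : ℤ) (W : List DStep) :
    NN h W ↔ ∀ k ≤ W.length, 0 ≤ h + stepSum (W.take k) := by
  constructor
  · intro H k _
    exact H _ (W.drop k) (List.take_append_drop k W).symm
  · rintro H X Y rfl
    have := H X.length (by simp)
    simpa using this

theorem NN.nonneg {h : ℤ} {W : List DStep} (H : NN h W) : 0 ≤ h := by
  simpa using H [] W rfl

theorem NN.final {h : ℤ} {W : List DStep} (H : NN h W) : 0 ≤ h + stepSum W := by
  simpa using H W [] (by simp)

theorem NN.mono {h h' : ℤ} {W : List DStep} (H : NN h W) (hh : h ≤ h') : NN h' W := by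
  intro X Y e
  have := H X Y e
  omega

theorem NN_append (h : ℤ) (X Y : List DStep) :
    NN h (X ++ Y) ↔ NN h X ∧ NN (h + stepSum X) Y := by
  constructor
  · intro H
    refine ⟨?_, ?_⟩
    · rintro A B rfl
      exact H A (B ++ Y) (by simp)
    · rintro A B rfl
      have := H (X ++ A) B (by simp)
      simpa [add_assoc] using this
  · rintro ⟨H1, H2⟩ A B e
    rcases List.append_eq_append_iff.1 e with ⟨C, rfl, rfl⟩ | ⟨C, rfl, rfl⟩
    · have := H2 C B rfl
      simpa [add_assoc] using this
    · exact H1 A C rfl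

theorem NN_nil (h : ℤ) : NN h [] ↔ 0 ≤ h := by
  constructor
  · exact fun H => H.nonneg
  · intro H X Y e
    obtain ⟨rfl, rfl⟩ := List.append_eq_nil_iff.1 e.symm
    simpa using H

theorem NN_cons (h : ℤ) (x : DStep) (W : List DStep) :
    NN h (x :: W) ↔ 0 ≤ h ∧ NN (h + x.val) W := by
  constructor
  · intro H
    refine ⟨H.nonneg, ?_⟩
    rintro A B rfl
    have := H (x :: A) B rfl
    simpa [add_assoc] using this
  · rintro ⟨H1, H2⟩ A B e
    cases A with
    | nil => simpa using H1
    | cons a A =>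
      simp only [List.cons_append, List.cons.injEq] at e
      obtain ⟨rfl, rfl⟩ := e
      have := H2 A B rfl
      simpa [add_assoc] using this

theorem NN_repU (h : ℤ) (k : ℕ) : NN h (List.replicate k DStep.U) ↔ 0 ≤ h := by
  induction k generalizing h with
  | zero => simp [NN_nil]
  | succ k ih => simp only [List.replicate_succ, NN_cons, ih, valU]; omega

theorem NN_repL (h : ℤ) (k : ℕ) : NN h (List.replicate k DStep.L) ↔ 0 ≤ h := by
  induction k generalizing h with
  | zero => simp [NN_nil]
  | succ k ih => simp only [List.replicate_succ, NN_cons, ih, valL]; omega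

theorem NN_repD (h : ℤ) (k : ℕ) : NN h (List.replicate k DStep.D) ↔ (k : ℤ) ≤ h := by
  induction k generalizing h with
  | zero => simp [NN_nil]
  | succ k ih => simp only [List.replicate_succ, NN_cons, ih, valD]; push_cast; omega

/-- The word `D^a L^b U^c`. -/
def pw (a b c : ℕ) : List DStep :=
  List.replicate a DStep.D ++ List.replicate b DStep.L ++ List.replicate c DStep.U

theorem NN_pw (h : ℤ) (a b c : ℕ) : NN h (pw a b c) ↔ (a : ℤ) ≤ h := by
  simp only [pw, NN_append, NN_repD, NN_repL, NN_repU, ss_append, ss_rep, valD, valL]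
  constructor
  · exact fun H => H.1.1
  · intro H
    exact ⟨⟨H, by omega⟩, by omega⟩

@[simp] theorem ss_pw (a b c : ℕ) : stepSum (pw a b c) = c - a := by
  simp [pw]; ring

@[simp] theorem length_pw (a b c : ℕ) : (pw a b c).length = a + b + c := by
  simp [pw, add_assoc]

/-! ### Forbidden patterns -/

/-- `U W D`, with its first step in position `r`, is a forbidden pattern. -/
def BC (m d r : ℕ) (W : List DStep) : Prop :=
  (∃ k, k + 2 ≤ m ∧ W = List.replicate (k * d) DStep.L) ∨
  (∃ P, W = DStep.U :: (P ++ [DStep.D]) ∧ (r + 1) % d ≠ 0 ∧ (r + P.length + 3) % d ≠ 0 ∧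
    stepSum P = 0 ∧ NN 0 P)

/-- `V`, started at position `r`, contains a forbidden pattern. -/
def Bad (m d r : ℕ) (V : List DStep) : Prop :=
  ∃ pre W suf, V = pre ++ (DStep.U :: (W ++ [DStep.D])) ++ suf ∧ BC m d (r + pre.length) W

theorem NN_UD {W : List DStep} (h0 : stepSum W = 0) (h1 : NN 0 W) :
    NN 0 (DStep.U :: (W ++ [DStep.D])) := by
  simp only [NN_cons, NN_append, valU, valD, h0]
  exact ⟨le_rfl, h1.mono (by norm_num), by norm_num, by rw [NN_nil]; norm_num⟩

theorem BC.nn {m d r : ℕ} {W : List DStep} (H : BC m d r W) : stepSum W = 0 ∧ NN 0 W := by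
  rcases H with ⟨k, _, rfl⟩ | ⟨P, rfl, _, _, h0, h1⟩
  · exact ⟨by simp, by rw [NN_repL]⟩
  · exact ⟨by simp [h0], NN_UD h0 h1⟩

theorem BC_congr {m d r r' : ℕ} (h : r % d = r' % d) {W : List DStep} (H : BC m d r W) :
    BC m d r' W := by
  rcases H with ⟨k, hk, rfl⟩ | ⟨P, rfl, h1, h2, h3, h4⟩
  · exact Or.inl ⟨k, hk, rfl⟩
  · refine Or.inr ⟨P, rfl, ?_, ?_, h3, h4⟩
    · have e : (r + 1) % d = (r' + 1) % d := Nat.ModEq.add_right 1 h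
      rwa [← e]
    · have e : (r + P.length + 3) % d = (r' + P.length + 3) % d :=
        Nat.ModEq.add_right 3 (Nat.ModEq.add_right P.length h)
      rwa [← e]

theorem Bad_congr {m d r r' : ℕ} (h : r % d = r' % d) (V : List DStep) :
    Bad m d r V ↔ Bad m d r' V := by
  constructor
  · rintro ⟨pre, W, suf, e, H⟩
    exact ⟨pre, W, suf, e, BC_congr (Nat.ModEq.add_right pre.length h) H⟩
  · rintro ⟨pre, W, suf, e, H⟩
    exact ⟨pre, W, suf, e, BC_congr (Nat.ModEq.add_right pre.length h.symm) H⟩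

theorem arch_pos {W X Y : List DStep} (h1 : NN 0 W)
    (e : DStep.U :: (W ++ [DStep.D]) = X ++ Y) (hX : X ≠ []) (hY : Y ≠ []) : 0 < stepSum X := by
  cases X with
  | nil => exact absurd rfl hX
  | cons x X =>
    simp only [List.cons_append, List.cons.injEq] at e
    obtain ⟨rfl, e⟩ := e
    obtain ⟨Y', y, rfl⟩ := List.eq_nil_or_concat' Y |>.resolve_left hY
    rw [← List.append_assoc] at e
    have e' := (List.append_inj' e rfl).1
    have := h1 X Y' e'
    simp only [ss_cons, valU]
    omega

theorem Bad_append {m d r : ℕ} {X Y : List DStep} (h0 : stepSum X = 0) (h1 : NN 0 X) :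
    Bad m d r (X ++ Y) ↔ Bad m d r X ∨ Bad m d (r + X.length) Y := by
  constructor
  · rintro ⟨pre, W, suf, e, H⟩
    rw [List.append_assoc] at e
    rcases List.append_eq_append_iff.1 e with ⟨C, rfl, e2⟩ | ⟨C, rfl, e2⟩
    · right
      refine ⟨C, W, suf, by rw [e2, List.append_assoc], ?_⟩
      simpa [add_assoc] using H
    · rcases List.append_eq_append_iff.1 e2 with ⟨E, rfl, e3⟩ | ⟨E, e3, e4⟩
      · left
        exact ⟨pre, W, E, by simp, H⟩
      · by_cases hC : C = []
        · subst hC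
          right
          refine ⟨[], W, suf, by rw [e4]; simp only [List.nil_append] at e3; rw [e3]; simp, ?_⟩
          simpa using H
        by_cases hE : E = []
        · subst hE
          left
          refine ⟨pre, W, [], by rw [e3]; simp, H⟩
        have p1 := arch_pos H.nn.2 e3 hC hE
        have p2 := h1 pre C rfl
        simp only [ss_append] at h0
        omega
  · rintro (⟨pre, W, suf, rfl, H⟩ | ⟨pre, W, suf, rfl, H⟩)
    · exact ⟨pre, W, suf ++ Y, by simp, H⟩
    · exact ⟨X ++ pre, W, suf, by simp, by simpa [add_assoc] using H⟩

theorem not_Bad_repL {m d r : ℕ} (k : ℕ) : ¬ Bad m d r (List.replicate k DStep.L) := by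
  rintro ⟨pre, W, suf, e, _⟩
  have : DStep.U ∈ List.replicate k DStep.L := by rw [e]; simp
  have := List.eq_of_mem_replicate this
  cases this

theorem Bad_UD {m d r : ℕ} {V : List DStep} (h0 : stepSum V = 0) (h1 : NN 0 V) :
    Bad m d r (DStep.U :: (V ++ [DStep.D])) ↔ Bad m d (r + 1) V ∨ BC m d r V := by
  constructor
  · rintro ⟨pre, W, suf, e, H⟩
    obtain ⟨w0, w1⟩ := H.nn
    by_cases hs : suf = []
    · subst hs
      by_cases hp : pre = []
      · subst hp
        right
        simp only [List.nil_append, List.append_nil, List.cons.injEq, true_and] at e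
        rw [List.append_left_inj] at e
        subst e
        simpa using H
      · have p := arch_pos h1 (e.trans (by simp)) hp (Y := DStep.U :: (W ++ [DStep.D])) (by simp)
        have := congrArg stepSum e
        simp [h0, w0] at this
        omega
    · have hne : pre ++ (DStep.U :: (W ++ [DStep.D])) ≠ [] := by simp
      have p := arch_pos h1 e hne hs
      cases pre with
      | nil => simp [w0] at p
      | cons x pre =>
        obtain ⟨suf', y, rfl⟩ := List.eq_nil_or_concat' suf |>.resolve_left hs
        simp only [List.cons_append, List.cons.injEq] at e
        obtain ⟨rfl, e⟩ := e
        rw [← List.append_assoc] at e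
        have e' := (List.append_inj' e rfl).1
        left
        refine ⟨pre, W, suf', by rw [e'], ?_⟩
        have : r + 1 + pre.length = r + (pre.length + 1) := by omega
        rw [this]
        simpa using H
  · rintro (⟨pre, W, suf, rfl, H⟩ | H)
    · refine ⟨DStep.U :: pre, W, suf ++ [DStep.D], by simp, ?_⟩
      have : r + 1 + pre.length = r + (pre.length + 1) := by omega
      rw [this] at H
      simpa using H
    · exact ⟨[], V, [], by simp, by simpa using H⟩

/-! ### Paths -/

/-- `M` consists of `n` pieces. -/
def PW (d n : ℕ) (M : List DStep) : Prop :=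
  M.length = d * n ∧ ∀ i < n, IsPieceWord d ((M.drop (d * i)).take d)

/-- Core of the completed path. -/
def core (s t : ℕ) (M : List DStep) : List DStep :=
  List.replicate s DStep.U ++ M ++ List.replicate t DStep.D

theorem core_sum {s t : ℕ} {M : List DStep} (h : (s : ℤ) + stepSum M = t) :
    stepSum (core s t M) = 0 := by
  simp [core]; omega

theorem core_NN {s t : ℕ} {M : List DStep} (h : (s : ℤ) + stepSum M = t) :
    NN 0 (core s t M) ↔ NN s M := by
  simp only [core, NN_append, NN_repU, NN_repD, ss_append, ss_rep, valU]
  constructor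
  · rintro ⟨⟨_, H⟩, _⟩
    simpa using H
  · intro H
    exact ⟨⟨le_rfl, by simpa using H⟩, by omega⟩

theorem bad_iff (m d : ℕ) (V : List DStep) : Bad m d 0 V ↔ HasShortUD m d V ∨ HasLambda d V := by
  constructor
  · rintro ⟨pre, W, suf, e, ⟨k, hk, rfl⟩ | ⟨P, rfl, h1, h2, h3, h4⟩⟩
    · exact Or.inl ⟨k, hk, pre, suf, by rw [e]; simp⟩
    · refine Or.inr ⟨pre, P, suf, by rw [e]; simp, by simpa using h1, by simpa using h2, h3, ?_⟩
      rw [NN_iff_take] at h4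
      simpa using h4
  · rintro (⟨k, hk, pre, suf, e⟩ | ⟨pre, P, suf, e, h1, h2, h3, h4⟩)
    · exact ⟨pre, _, suf, by rw [← e]; simp, Or.inl ⟨k, hk, rfl⟩⟩
    · refine ⟨pre, _, suf, by rw [e]; simp, Or.inr ⟨P, rfl, by simpa using h1,
        by simpa using h2, h3, ?_⟩⟩
      rw [NN_iff_take]
      simpa using h4

theorem good_iff {m d n s t : ℕ} {M : List DStep} :
    IsGoodPath m d n s t M ↔ PW d n M ∧ (s : ℤ) + stepSum M = t ∧ NN s M ∧
      ¬ Bad m d (d - s) (core s t M) := by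
  have key : (s : ℤ) + stepSum M = t → NN s M →
      (Bad m d (d - s) (core s t M) ↔ Bad m d 0 (hatPath d s t M)) := by
    intro h1 h2
    have e : hatPath d s t M = List.replicate (d - s) DStep.L ++
        (core s t M ++ List.replicate (d - t) DStep.L) := by simp [hatPath, core]
    rw [e, Bad_append (by simp) (by rw [NN_repL]), Bad_append (core_sum h1) ((core_NN h1).2 h2)]
    simp [not_Bad_repL]
  unfold IsGoodPath IsDLUPath RegularWord PW
  rw [← NN_iff_take]
  constructor
  · rintro ⟨⟨h1, h2, h3, h4⟩, h5, h6⟩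
    refine ⟨⟨h1, h2⟩, h3, h4, ?_⟩
    rw [key h3 h4, bad_iff]
    tauto
  · rintro ⟨⟨h1, h2⟩, h3, h4, h5⟩
    rw [key h3 h4, bad_iff] at h5
    tauto

/-- Prime paths. -/
def Prm (m d n s t : ℕ) (M : List DStep) : Prop :=
  IsGoodPath m d n s t M ∧ NN (s - 1) M

theorem PW_append {d k l : ℕ} {N R : List DStep} (hN : N.length = d * k) :
    PW d (k + l) (N ++ R) ↔ PW d k N ∧ PW d l R := by
  have b1 : ∀ i < k, ((N ++ R).drop (d * i)).take d = (N.drop (d * i)).take d := by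
    intro i hi
    have : d * (i + 1) ≤ d * k := Nat.mul_le_mul_left d hi
    rw [mul_add, mul_one] at this
    rw [List.drop_append_of_le_length (by omega), List.take_append_of_le_length]
    rw [List.length_drop]; omega
  have b2 : ∀ j, (N ++ R).drop (d * (k + j)) = R.drop (d * j) := by
    intro j
    rw [mul_add, ← hN, List.drop_append]
    simp
  constructor
  · rintro ⟨h1, h2⟩
    refine ⟨⟨hN, fun i hi => ?_⟩, ?_, fun j hj => ?_⟩
    · rw [← b1 i hi]; exact h2 i (by omega)
    · rw [List.length_append, mul_add] at h1; omega
    · rw [← b2]; exact h2 _ (by omega)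
  · rintro ⟨⟨h1, h2⟩, h3, h4⟩
    refine ⟨by rw [List.length_append, mul_add]; omega, fun i hi => ?_⟩
    by_cases hik : i < k
    · rw [b1 i hik]; exact h2 i hik
    · obtain ⟨j, rfl⟩ := Nat.exists_eq_add_of_le (not_lt.1 hik)
      rw [b2]; exact h4 j (by omega)

theorem PW_one {d : ℕ} {P : List DStep} :
    PW d 1 P ↔ ∃ a b c, a + b + c = d ∧ P = pw a b c := by
  constructor
  · rintro ⟨h1, h2⟩
    have := h2 0 (by norm_num)
    rw [mul_zero, List.drop_zero, List.take_of_length_le (by omega)] at this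
    exact this
  · rintro ⟨a, b, c, h, rfl⟩
    refine ⟨by simp [h], fun i hi => ?_⟩
    obtain rfl : i = 0 := by omega
    rw [mul_zero, List.drop_zero, List.take_of_length_le (by simp [h])]
    exact ⟨a, b, c, h, rfl⟩

theorem PW_zero {d : ℕ} {P : List DStep} : PW d 0 P ↔ P = [] := by
  constructor
  · rintro ⟨h1, _⟩
    simpa using h1
  · rintro rfl
    exact ⟨by simp, by simp⟩

theorem PW_split {d k l : ℕ} {M : List DStep} (h : PW d (k + l) M) :
    ∃ N R, M = N ++ R ∧ PW d k N ∧ PW d l R := by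
  have hl : (M.take (d * k)).length = d * k := by
    rw [List.length_take, h.1, mul_add]; omega
  refine ⟨M.take (d * k), M.drop (d * k), (List.take_append_drop _ _).symm, ?_⟩
  rw [← PW_append hl, List.take_append_drop]
  exact h

theorem PW_repL {d : ℕ} (n : ℕ) : PW d n (List.replicate (d * n) DStep.L) := by
  refine ⟨by simp, fun i hi => ⟨0, d, 0, by simp, ?_⟩⟩
  have : d * (i + 1) ≤ d * n := Nat.mul_le_mul_left d hi
  rw [mul_add, mul_one] at this
  rw [List.drop_replicate, List.take_replicate]
  simp; omega

/-! ### Prime paths -/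

theorem core_succ (s t : ℕ) (M : List DStep) :
    core (s + 1) (t + 1) M = DStep.U :: (core s t M ++ [DStep.D]) := by
  simp [core, List.replicate_succ, ← List.replicate_succ']

theorem BC_core {m d n s t : ℕ} {M : List DStep} (hd : 1 ≤ d) (hs : s + 1 ≤ d) (ht : t + 1 ≤ d)
    (hM : M.length = d * n) (h0 : (s : ℤ) + stepSum M = t) :
    BC m d (d - (s + 1)) (core s t M) ↔
      (s = 0 ∧ t = 0 ∧ n + 2 ≤ m ∧ M = List.replicate (d * n) DStep.L) ∨ NN ((s : ℤ) - 1) M := by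
  constructor
  · rintro (⟨k, hk, e⟩ | ⟨P, e, h1, h2, h3, h4⟩)
    · left
      have hs0 : s = 0 := by
        by_contra hne
        have : DStep.U ∈ List.replicate (k * d) DStep.L := by rw [← e]; simp [core, hne]
        cases List.eq_of_mem_replicate this
      have ht0 : t = 0 := by
        by_contra hne
        have : DStep.D ∈ List.replicate (k * d) DStep.L := by rw [← e]; simp [core, hne]
        cases List.eq_of_mem_replicate this
      subst hs0 ht0
      simp only [core, List.replicate_zero, List.nil_append, List.append_nil] at e
      have hl : k * d = d * n := by rw [← hM, e]; simp
      have hk' : k = n := by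
        rw [mul_comm] at hl
        exact Nat.eq_of_mul_eq_mul_left hd hl
      refine ⟨rfl, rfl, by omega, by rw [e, hl]⟩
    · right
      have hl := congrArg List.length e
      simp only [core, List.length_append, List.length_replicate, List.length_cons,
        List.length_nil, hM] at hl
      cases s with
      | zero =>
        exfalso; apply h1
        rw [show d - (0 + 1) + 1 = d by omega, Nat.mod_self]
      | succ s =>
        cases t with
        | zero =>
          exfalso; apply h2
          rw [show d - (s + 1 + 1) + P.length + 3 = d * (n + 1) by rw [mul_add]; omega]
          exact Nat.mul_mod_right _ _
        | succ t =>
          rw [core_succ] at e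
          simp only [List.cons.injEq, true_and, List.append_left_inj] at e
          subst e
          push_cast at h0 ⊢
          rw [core_NN (by omega)] at h4
          simpa using h4
  · rintro (⟨rfl, rfl, hn, rfl⟩ | h)
    · left
      exact ⟨n, hn, by simp [core, mul_comm]⟩
    · right
      have h1 := h.nonneg
      have h2 := h.final
      obtain ⟨s, rfl⟩ : ∃ s', s = s' + 1 := ⟨s - 1, by omega⟩
      obtain ⟨t, rfl⟩ : ∃ t', t = t' + 1 := ⟨t - 1, by omega⟩
      push_cast at h0 h
      refine ⟨core s t M, core_succ s t M, ?_, ?_, core_sum (by omega), ?_⟩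
      · rw [Nat.mod_eq_of_lt (by omega)]; omega
      · rw [show d - (s + 1 + 1) + (core s t M).length + 3 = (t + 1) + d * (n + 1) by
          simp only [core, List.length_append, List.length_replicate, hM]
          rw [mul_add]; omega]
        rw [Nat.add_mul_mod_self_left, Nat.mod_eq_of_lt (by omega)]
        omega
      · rw [core_NN (by omega)]
        simpa using h

theorem Prm_succ {m d n s t : ℕ} {M : List DStep} (hd : 1 ≤ d) (hs : s + 1 ≤ d)
    (ht : t + 1 ≤ d) :
    Prm m d n (s + 1) (t + 1) M ↔ IsGoodPath m d n s t M ∧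
      ¬ ((s = 0 ∧ t = 0 ∧ n + 2 ≤ m ∧ M = List.replicate (d * n) DStep.L) ∨
        NN ((s : ℤ) - 1) M) := by
  unfold Prm
  rw [good_iff, good_iff, core_succ]
  constructor
  · rintro ⟨⟨h1, h2, h3, h4⟩, h5⟩
    push_cast at h2 h5
    have h2' : (s : ℤ) + stepSum M = t := by omega
    have h5' : NN s M := by simpa using h5
    rw [Bad_UD (core_sum h2') ((core_NN h2').2 h5'), not_or,
      BC_core hd hs ht h1.1 h2'] at h4
    rw [show d - (s + 1) + 1 = d - s by omega] at h4
    exact ⟨⟨h1, h2', h5', h4.1⟩, h4.2⟩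
  · rintro ⟨⟨h1, h2, h3, h4⟩, h5⟩
    push_cast
    refine ⟨⟨h1, by omega, h3.mono (by omega), ?_⟩, by simpa using h3⟩
    rw [Bad_UD (core_sum h2) ((core_NN h2).2 h3), not_or, BC_core hd hs ht h1.1 h2]
    rw [show d - (s + 1) + 1 = d - s by omega]
    exact ⟨h4, h5⟩

/-! ### Reversal -/

/-- Exchange up and down steps. -/
def flp : DStep → DStep
  | .U => .D
  | .D => .U
  | .L => .L

@[simp] theorem flp_flp (x : DStep) : flp (flp x) = x := by cases x <;> rfl
@[simp] theorem flp_val (x : DStep) : (flp x).val = - x.val := by cases x <;> rfl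

/-- Reversal of a path. -/
def rv (W : List DStep) : List DStep := (W.map flp).reverse

@[simp] theorem rv_nil : rv [] = [] := rfl
@[simp] theorem rv_append (X Y : List DStep) : rv (X ++ Y) = rv Y ++ rv X := by simp [rv]
@[simp] theorem rv_cons (x : DStep) (Y : List DStep) : rv (x :: Y) = rv Y ++ [flp x] := by
  simp [rv]
@[simp] theorem rv_rep (k : ℕ) (x : DStep) :
    rv (List.replicate k x) = List.replicate k (flp x) := by
  simp [rv]
@[simp] theorem rv_length (X : List DStep) : (rv X).length = X.length := by simp [rv]
@[simp] theorem rv_rv (X : List DStep) : rv (rv X) = X := by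
  have : flp ∘ flp = id := by funext x; simp
  simp [rv, List.map_reverse, this]
@[simp] theorem rv_sum (X : List DStep) : stepSum (rv X) = - stepSum X := by
  induction X with
  | nil => simp
  | cons x X ih => simp [ih]

theorem rv_NN {h : ℤ} {W : List DStep} (H : NN h W) : NN (h + stepSum W) (rv W) := by
  intro X Y e
  have e2 : W = rv Y ++ rv X := by rw [← rv_append, ← e, rv_rv]
  have := H _ _ e2
  rw [e2]
  simp at this ⊢
  omega

theorem rv_pw (a b c : ℕ) : rv (pw a b c) = pw c b a := by
  simp [pw, flp]

theorem rv_PW {d n : ℕ} {M : List DStep} (h : PW d n M) : PW d n (rv M) := by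
  induction n generalizing M with
  | zero => rw [PW_zero] at h; subst h; simp [PW_zero]
  | succ n ih =>
    rw [add_comm] at h
    obtain ⟨N, R, rfl, h1, h2⟩ := PW_split h
    rw [rv_append, PW_append (by rw [rv_length, h2.1])]
    refine ⟨ih h2, ?_⟩
    obtain ⟨a, b, c, e, rfl⟩ := PW_one.1 h1
    rw [rv_pw]
    exact PW_one.2 ⟨c, b, a, by omega, rfl⟩

theorem rv_BC {m d r r' : ℕ} {W : List DStep} (hr : d ∣ r + W.length + 2 + r')
    (H : BC m d r W) : BC m d r' (rv W) := by
  rcases H with ⟨k, hk, rfl⟩ | ⟨P, rfl, h1, h2, h3, h4⟩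
  · exact Or.inl ⟨k, hk, by simp [flp]⟩
  · right
    simp only [List.length_cons, List.length_append, List.length_nil] at hr
    refine ⟨rv P, by simp [flp], ?_, ?_, by simp [h3], ?_⟩
    · intro h
      apply h2
      rw [← Nat.dvd_iff_mod_eq_zero] at h ⊢
      refine (Nat.dvd_add_left h).1 ?_
      convert hr using 1; omega
    · intro h
      apply h1
      rw [rv_length] at h
      rw [← Nat.dvd_iff_mod_eq_zero] at h ⊢
      refine (Nat.dvd_add_left h).1 ?_
      convert hr using 1; omega
    · have := rv_NN h4
      rwa [h3] at this

theorem rv_Bad {m d r r' : ℕ} {V : List DStep} (hr : d ∣ r + V.length + r')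
    (H : Bad m d r V) : Bad m d r' (rv V) := by
  obtain ⟨pre, W, suf, rfl, H⟩ := H
  refine ⟨rv suf, rv W, rv pre, by simp [flp], rv_BC ?_ H⟩
  simp only [List.length_append, List.length_cons, List.length_nil] at hr
  convert hr using 1
  rw [rv_length]; omega

theorem rv_core (s t : ℕ) (M : List DStep) : rv (core s t M) = core t s (rv M) := by
  simp [core, flp]

theorem rv_good {m d n s t : ℕ} {M : List DStep} (hs : s ≤ d) (ht : t ≤ d)
    (h : IsGoodPath m d n s t M) : IsGoodPath m d n t s (rv M) := by
  rw [good_iff] at h ⊢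
  obtain ⟨h1, h2, h3, h4⟩ := h
  refine ⟨rv_PW h1, by simp; omega, by rw [← h2]; exact rv_NN h3, fun h5 => h4 ?_⟩
  have := rv_Bad (r' := d - s) ?_ h5
  · rwa [rv_core, rv_rv] at this
  · refine ⟨n + 2, ?_⟩
    simp only [core, List.length_append, List.length_replicate, rv_length, h1.1]
    rw [mul_add]; omega

theorem gCount_symm {m d n s t : ℕ} (hs : s ≤ d) (ht : t ≤ d) :
    gCount m d n s t = gCount m d n t s := by
  unfold gCount
  have : {M | IsGoodPath m d n s t M} = rv '' {M | IsGoodPath m d n t s M} := by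
    ext M
    constructor
    · intro h
      exact ⟨rv M, rv_good hs ht h, rv_rv M⟩
    · rintro ⟨N, h, rfl⟩
      exact rv_good ht hs h
  rw [this, Set.ncard_image_of_injective]
  exact Function.LeftInverse.injective rv_rv

/-! ### Concatenation -/

theorem good_concat {m d k l s t a b c : ℕ} {N R : List DStep} (hs : s ≤ d)
    (habc : a + b + c = d) (hN : N.length = d * k)
    (hNa : (s : ℤ) + stepSum N = a) :
    IsGoodPath m d (k + (1 + l)) s t (N ++ (pw a b c ++ R)) ↔
      IsGoodPath m d k s a N ∧ IsGoodPath m d l c t R := by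
  rw [good_iff, good_iff, good_iff, PW_append hN, PW_append (by simp [habc])]
  have p1 : PW d 1 (pw a b c) := PW_one.2 ⟨a, b, c, habc, rfl⟩
  have e1 : (s : ℤ) + stepSum (N ++ (pw a b c ++ R)) = t ↔ (c : ℤ) + stepSum R = t := by
    simp only [ss_append, ss_pw]
    constructor <;> intro h <;> omega
  have e2 : NN s (N ++ (pw a b c ++ R)) ↔ NN s N ∧ NN c R := by
    rw [NN_append, NN_append, NN_pw, hNa, ss_pw, show (a : ℤ) + (c - a) = c by ring]
    simp
  have e3 : core s t (N ++ (pw a b c ++ R)) =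
      core s a N ++ (List.replicate b DStep.L ++ core c t R) := by
    simp [core, pw]
  rw [e1, e2, e3]
  have key : NN s N → (Bad m d (d - s) (core s a N ++ (List.replicate b DStep.L ++ core c t R)) ↔
      Bad m d (d - s) (core s a N) ∨ Bad m d (d - c) (core c t R)) := by
    intro h
    rw [Bad_append (core_sum hNa) ((core_NN hNa).2 h), Bad_append (by simp) (by rw [NN_repL])]
    have : (d - s + (core s a N).length + (List.replicate b DStep.L).length) % d
        = (d - c) % d := by
      simp only [core, List.length_append, List.length_replicate, hN]
      rw [show d - s + (s + d * k + a) + b = (d - c) + d * (k + 1) by rw [mul_add]; omega]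
      exact Nat.add_mul_mod_self_left _ _ _
    rw [Bad_congr this]
    simp [not_Bad_repL]
  constructor
  · rintro ⟨⟨h1, _, h2⟩, h3, ⟨h4, h5⟩, h6⟩
    rw [key h4, not_or] at h6
    exact ⟨⟨h1, hNa, h4, h6.1⟩, h2, h3, h5, h6.2⟩
  · rintro ⟨⟨h1, _, h4, h5⟩, h2, h3, h6, h7⟩
    refine ⟨⟨h1, p1, h2⟩, h3, ⟨h4, h6⟩, ?_⟩
    rw [key h4, not_or]
    exact ⟨h5, h7⟩

/-! ### Counting -/

theorem good_finite (m d n s t : ℕ) : {M | IsGoodPath m d n s t M}.Finite :=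
  (List.finite_length_eq DStep (d * n)).subset fun _ h => h.1.1

theorem prm_finite (m d n s t : ℕ) : {M | Prm m d n s t M}.Finite :=
  (good_finite m d n s t).subset fun _ h => h.1

/-- The finset of good paths. -/
noncomputable def gF (m d n s t : ℕ) : Finset (List DStep) := (good_finite m d n s t).toFinset

/-- The finset of prime paths. -/
noncomputable def pF (m d n s t : ℕ) : Finset (List DStep) := (prm_finite m d n s t).toFinset

@[simp] theorem mem_gF {m d n s t : ℕ} {M : List DStep} :
    M ∈ gF m d n s t ↔ IsGoodPath m d n s t M := by simp [gF]

@[simp] theorem mem_pF {m d n s t : ℕ} {M : List DStep} :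
    M ∈ pF m d n s t ↔ Prm m d n s t M := by simp [pF]

theorem gCount_eq (m d n s t : ℕ) : gCount m d n s t = (gF m d n s t).card := by
  unfold gCount gF
  exact Set.ncard_eq_toFinset_card _ _

theorem pF_sub (m d n s t : ℕ) : pF m d n s t ⊆ gF m d n s t := by
  intro M h
  simp at h ⊢
  exact h.1

theorem pF_zero_right (m d n s : ℕ) : pF m d n s 0 = ∅ := by
  ext M
  simp only [mem_pF, Finset.notMem_empty, iff_false]
  rintro ⟨h1, h2⟩
  have h3 := h2.final
  have h4 := (good_iff.1 h1).2.1
  push_cast at h4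
  omega

theorem pF_zero_left (m d n t : ℕ) : pF m d n 0 t = ∅ := by
  ext M
  simp only [mem_pF, Finset.notMem_empty, iff_false]
  rintro ⟨h1, h2⟩
  have h3 := h2.nonneg
  simp at h3

theorem pCount_succ {m d n s t : ℕ} (hd : 1 ≤ d) (hs : s + 1 ≤ d) (ht : t + 1 ≤ d)
    (hst : s ≠ 0 ∨ t ≠ 0) :
    (pF m d n (s + 1) (t + 1)).card + (pF m d n s t).card = (gF m d n s t).card := by
  classical
  have : pF m d n (s + 1) (t + 1) = gF m d n s t \ pF m d n s t := by
    ext M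
    simp only [mem_pF, Finset.mem_sdiff, mem_gF]
    rw [Prm_succ hd hs ht]
    unfold Prm
    constructor
    · rintro ⟨h1, h2⟩; exact ⟨h1, fun h => h2 (Or.inr h.2)⟩
    · rintro ⟨h1, h2⟩
      refine ⟨h1, ?_⟩
      rintro (⟨h3, h4, _⟩ | h3)
      · omega
      · exact h2 ⟨h1, h3⟩
  rw [this, Finset.card_sdiff_add_card_eq_card (pF_sub _ _ _ _ _)]

theorem good_L {m d n : ℕ} : IsGoodPath m d n 0 0 (List.replicate (d * n) DStep.L) := by
  rw [good_iff]
  refine ⟨PW_repL n, by simp, by rw [NN_repL]; simp, ?_⟩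
  simp only [core, List.replicate_zero, List.nil_append, List.append_nil]
  exact not_Bad_repL _

theorem pCount_one {m d n : ℕ} (hd : 1 ≤ d) :
    (pF m d n 1 1).card + (if n < m - 1 then 1 else 0) = (gF m d n 0 0).card := by
  classical
  have key : ∀ M, Prm m d n 1 1 M ↔ IsGoodPath m d n 0 0 M ∧
      ¬ (n + 2 ≤ m ∧ M = List.replicate (d * n) DStep.L) := by
    intro M
    rw [show (1 : ℕ) = 0 + 1 from rfl, Prm_succ hd (by omega) (by omega)]
    have : ¬ NN (-1 : ℤ) M := fun h => by have := h.nonneg; simp at this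
    simp [this]
  split_ifs with h
  · have : pF m d n 1 1 = (gF m d n 0 0).erase (List.replicate (d * n) DStep.L) := by
      ext M
      have : n + 2 ≤ m := by omega
      simp [key, this, and_comm]
    rw [this, Finset.card_erase_add_one]
    simpa using good_L
  · have : pF m d n 1 1 = gF m d n 0 0 := by
      ext M
      have : ¬ (n + 2 ≤ m) := by omega
      simp [key, this]
    rw [this, add_zero]

/-- Index set of the first-return decomposition. -/
noncomputable def idx (m d n s t : ℕ) :
    Finset (Σ _ : ℕ × ℕ, Σ _ : ℕ, Σ _ : ℕ, List DStep × List DStep) :=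
  (Finset.HasAntidiagonal.antidiagonal n).sigma fun kl => (Finset.Icc 1 d).sigma fun a =>
    (Finset.range (d - a + 1)).sigma fun c => pF m d kl.1 s a ×ˢ gF m d kl.2 c t

/-- Glue the parts of the first-return decomposition. -/
def glue (d : ℕ) (x : Σ _ : ℕ × ℕ, Σ _ : ℕ, Σ _ : ℕ, List DStep × List DStep) : List DStep :=
  x.2.2.2.1 ++ (pw x.2.1 (d - x.2.1 - x.2.2.1) x.2.2.1 ++ x.2.2.2.2)

theorem glue_le {m d k k' s a b c a' b' c' : ℕ} {N R N' R' : List DStep}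
    (habc : a + b + c = d)
    (h1 : Prm m d k s a N) (h2 : Prm m d k' s a' N')
    (e : N ++ (pw a b c ++ R) = N' ++ (pw a' b' c' ++ R')) : k' ≤ k := by
  by_contra hlt
  push Not at hlt
  have hN := (good_iff.1 h1.1).1.1
  have hN' := (good_iff.1 h2.1).1.1
  have hm : d * (k + 1) ≤ d * k' := Nat.mul_le_mul_left d hlt
  rw [mul_add, mul_one] at hm
  rw [← List.append_assoc] at e
  have hp : N ++ pw a b c <+: N' := by
    refine List.prefix_of_prefix_length_le (List.prefix_append _ R)
      (by rw [e]; exact List.prefix_append _ _) ?_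
    simp; omega
  obtain ⟨E, rfl⟩ := hp
  have h3 := h2.2
  rw [NN_append, NN_append, NN_pw] at h3
  have h4 := (good_iff.1 h1.1).2.1
  have := h3.1.2
  omega

theorem decomp {m d n s t : ℕ} (hs0 : 0 < s) (hs : s ≤ d) :
    (idx m d n s t).card = (gF m d (n + 1) s t \ pF m d (n + 1) s t).card := by
  apply Finset.card_bij (fun x _ => glue d x)
  · rintro ⟨⟨k, l⟩, a, c, N, R⟩ hx
    simp only [idx, Finset.mem_sigma, Finset.HasAntidiagonal.mem_antidiagonal, Finset.mem_Icc, Finset.mem_range,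
      Finset.mem_product, mem_pF, mem_gF] at hx
    obtain ⟨hn, ⟨ha1, ha2⟩, hc, hN, hR⟩ := hx
    have g := good_iff.1 hN.1
    simp only [glue, Finset.mem_sdiff, mem_gF, mem_pF]
    refine ⟨?_, ?_⟩
    · rw [show n + 1 = k + (1 + l) by omega, good_concat hs (by omega) g.1.1 g.2.1]
      exact ⟨hN.1, hR⟩
    · rintro ⟨_, h⟩
      rw [NN_append, NN_append, NN_pw] at h
      have h4 := g.2.1
      have := h.2.1
      omega
  · rintro ⟨⟨k, l⟩, a, c, N, R⟩ hx ⟨⟨k', l'⟩, a', c', N', R'⟩ hx' e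
    simp only [idx, Finset.mem_sigma, Finset.HasAntidiagonal.mem_antidiagonal, Finset.mem_Icc, Finset.mem_range,
      Finset.mem_product, mem_pF, mem_gF] at hx hx'
    obtain ⟨hn, ⟨ha1, ha2⟩, hc, hN, hR⟩ := hx
    obtain ⟨hn', ⟨ha1', ha2'⟩, hc', hN', hR'⟩ := hx'
    simp only [glue] at e
    have hk : k = k' := le_antisymm (glue_le (by omega) hN' hN e.symm) (glue_le (by omega) hN hN' e)
    subst hk
    obtain rfl : l = l' := by omega
    have g := good_iff.1 hN.1
    have g' := good_iff.1 hN'.1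
    obtain ⟨rfl, e0⟩ := List.append_inj e (by rw [g.1.1, g'.1.1])
    obtain rfl : a = a' := by have := g.2.1; have := g'.2.1; omega
    have el : (pw a (d - a - c) c).length = (pw a (d - a - c') c').length := by
      rw [length_pw, length_pw]; omega
    obtain ⟨e1, rfl⟩ := List.append_inj e0 el
    have := congrArg stepSum e1
    simp only [ss_pw] at this
    obtain rfl : c = c' := by omega
    rfl
  · intro M hM
    simp only [Finset.mem_sdiff, mem_gF, mem_pF] at hM
    obtain ⟨hG, hP⟩ := hM
    have hnp : ¬ NN ((s : ℤ) - 1) M := fun h => hP ⟨hG, h⟩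
    have g := good_iff.1 hG
    classical
    have hex : ∃ j, ¬ NN ((s : ℤ) - 1) (M.take (d * j)) :=
      ⟨n + 1, by rwa [List.take_of_length_le (by rw [g.1.1])]⟩
    have hj := Nat.find_spec hex
    have hmin := fun i => Nat.find_min hex (m := i)
    have hle : Nat.find hex ≤ n + 1 :=
      Nat.find_min' hex (by rwa [List.take_of_length_le (by rw [g.1.1])])
    have hne : Nat.find hex ≠ 0 := by
      intro h
      rw [h] at hj
      apply hj
      simp only [mul_zero, List.take_zero, NN_nil]
      omega
    obtain ⟨k, hk⟩ := Nat.exists_eq_succ_of_ne_zero hne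
    rw [hk] at hj hle
    have hpos := not_not.1 (hmin k (by omega))
    obtain ⟨l, hl⟩ := Nat.exists_eq_add_of_le hle
    have hg1 := g.1
    rw [show n + 1 = k + (1 + l) by omega] at hg1
    obtain ⟨N, R0, rfl, hN, hR0⟩ := PW_split hg1
    obtain ⟨P, R, rfl, hP1, hR⟩ := PW_split hR0
    obtain ⟨a, b, c, habc, rfl⟩ := PW_one.1 hP1
    rw [List.take_left' hN.1] at hpos
    rw [← List.append_assoc, List.take_left' (by simp [hN.1, habc, mul_add])] at hj
    rw [NN_append, NN_pw] at hj
    have g3 := g.2.2.1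
    rw [NN_append, NN_append, NN_pw] at g3
    have hfin := hpos.final
    have ha : (s : ℤ) + stepSum N = a := by
      have h1 := g3.2.1
      by_contra hne
      exact hj ⟨hpos, by omega⟩
    rw [show n + 1 = k + (1 + l) by omega, good_concat hs habc hN.1 ha] at hG
    refine ⟨⟨(k, l), a, c, N, R⟩, ?_, ?_⟩
    · simp only [idx, Finset.mem_sigma, Finset.HasAntidiagonal.mem_antidiagonal, Finset.mem_Icc, Finset.mem_range,
        Finset.mem_product, mem_pF, mem_gF]
      refine ⟨by omega, ⟨by omega, by omega⟩, by omega, ⟨hG.1, hpos⟩, hG.2⟩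
    · simp only [glue]
      rw [show d - a - c = b by omega]

theorem gCount_succ {m d n s t : ℕ} (hs0 : 0 < s) (hs : s ≤ d) :
    (gF m d (n + 1) s t).card = (pF m d (n + 1) s t).card +
      ∑ kl ∈ Finset.HasAntidiagonal.antidiagonal n, ∑ a ∈ Finset.Icc 1 d, ∑ c ∈ Finset.range (d - a + 1),
        (pF m d kl.1 s a).card * (gF m d kl.2 c t).card := by
  classical
  have h := decomp (m := m) (n := n) (t := t) hs0 hs
  simp only [idx, Finset.card_sigma, Finset.card_product] at h
  rw [h, add_comm (pF m d (n + 1) s t).card, Finset.card_sdiff_add_card_eq_card (pF_sub _ _ _ _ _)]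

theorem gCount_zero {m d s t : ℕ} (hs0 : 0 < s) : gF m d 0 s t = pF m d 0 s t := by
  refine le_antisymm ?_ (pF_sub _ _ _ _ _)
  intro M h
  simp only [mem_gF, mem_pF] at h ⊢
  refine ⟨h, ?_⟩
  have := PW_zero.1 (good_iff.1 h).1
  subst this
  rw [NN_nil]
  omega

theorem good00_iff {m d l t c : ℕ} {R : List DStep} (hc : c ≤ d) :
    IsGoodPath m d (l + 1) 0 t (pw 0 (d - c) c ++ R) ↔ IsGoodPath m d l c t R := by
  have h := good_concat (m := m) (d := d) (k := 0) (l := l) (s := 0) (t := t) (a := 0)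
    (b := d - c) (c := c) (N := []) (R := R) (by omega) (by omega) (by simp) (by simp)
  rw [List.nil_append, show 0 + (1 + l) = l + 1 by omega] at h
  rw [h]
  have := good_L (m := m) (d := d) (n := 0)
  simp only [mul_zero, List.replicate_zero] at this
  simp [this]

theorem g00_succ {m d n : ℕ} :
    (gF m d (n + 1) 0 0).card = ∑ c ∈ Finset.range (d + 1), (gF m d n c 0).card := by
  rw [← Finset.card_sigma]
  symm
  apply Finset.card_bij (fun x _ => pw 0 (d - x.1) x.1 ++ x.2)
  · rintro ⟨c, R⟩ h
    simp only [Finset.mem_sigma, Finset.mem_range, mem_gF] at h ⊢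
    rw [good00_iff (by omega)]
    exact h.2
  · rintro ⟨c, R⟩ h ⟨c', R'⟩ h' e
    simp only [Finset.mem_sigma, Finset.mem_range] at h h' e
    obtain ⟨e1, rfl⟩ := List.append_inj e (by simp; omega)
    have := congrArg stepSum e1
    simp only [ss_pw] at this
    obtain rfl : c = c' := by omega
    rfl
  · intro M h
    simp only [mem_gF] at h
    have g := good_iff.1 h
    have hg1 := g.1
    rw [add_comm] at hg1
    obtain ⟨P, R, rfl, hP, hR⟩ := PW_split hg1
    obtain ⟨a, b, c, habc, rfl⟩ := PW_one.1 hP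
    have g3 := g.2.2.1
    rw [NN_append, NN_pw] at g3
    obtain rfl : a = 0 := by have := g3.1; simpa using this
    obtain rfl : b = d - c := by omega
    rw [good00_iff (by omega)] at h
    refine ⟨⟨c, R⟩, ?_, rfl⟩
    simp only [Finset.mem_sigma, Finset.mem_range, mem_gF]
    exact ⟨by omega, h⟩

theorem g00_zero {m d : ℕ} : (gF m d 0 0 0).card = 1 := by
  rw [Finset.card_eq_one]
  refine ⟨[], ?_⟩
  ext M
  simp only [mem_gF, Finset.mem_singleton]
  constructor
  · intro h
    exact PW_zero.1 (good_iff.1 h).1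
  · rintro rfl
    simpa using good_L (m := m) (d := d) (n := 0)

/-! ### Power series -/

open PowerSeries

/-- Generating function of good paths by number of pieces. -/
noncomputable def gS (m d s t : ℕ) : PowerSeries ℤ :=
  PowerSeries.mk fun n => ((gF m d n s t).card : ℤ)

/-- Generating function of prime paths by number of pieces. -/
noncomputable def pS (m d s t : ℕ) : PowerSeries ℤ :=
  PowerSeries.mk fun n => ((pF m d n s t).card : ℤ)

/-- Truncated geometric series. -/
noncomputable def cS (m : ℕ) : PowerSeries ℤ :=
  ∑ k ∈ Finset.range (m - 1), (PowerSeries.X : PowerSeries ℤ) ^ k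

theorem coeff_cS (m n : ℕ) : (cS m).coeff n = if n < m - 1 then 1 else 0 := by
  simp [cS, PowerSeries.coeff_X_pow]

theorem gS_symm {m d s t : ℕ} (hs : s ≤ d) (ht : t ≤ d) : gS m d s t = gS m d t s := by
  ext n
  simp only [gS, coeff_mk, ← gCount_eq]
  rw [gCount_symm hs ht]

theorem pS_succ {m d s t : ℕ} (hd : 1 ≤ d) (hs : s + 1 ≤ d) (ht : t + 1 ≤ d) :
    pS m d (s + 1) (t + 1) = gS m d s t - (if s = 0 ∧ t = 0 then cS m else pS m d s t) := by
  ext n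
  split_ifs with h
  · obtain ⟨rfl, rfl⟩ := h
    have := pCount_one (m := m) (n := n) hd
    simp only [pS, gS, map_sub, coeff_mk, coeff_cS, zero_add, ← this]
    split_ifs <;> simp
  · have := pCount_succ (m := m) (n := n) hd hs ht (by omega)
    simp only [pS, gS, map_sub, coeff_mk, ← this]
    simp

theorem g00 (m d : ℕ) : gS m d 0 0 = 1 + X * ∑ i ∈ Finset.range (d + 1), gS m d i 0 := by
  ext n
  cases n with
  | zero => simp [gS, g00_zero]
  | succ n =>
    rw [map_add, coeff_succ_X_mul]
    simp [gS, g00_succ, coeff_one]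

theorem gst {m d s t : ℕ} (hs0 : 0 < s) (hs : s ≤ d) : gS m d s t = pS m d s t +
    X * ∑ a ∈ Finset.Icc 1 d, pS m d s a * ∑ c ∈ Finset.range (d - a + 1), gS m d c t := by
  ext n
  cases n with
  | zero => simp [gS, pS, gCount_zero hs0]
  | succ n =>
    rw [map_add, coeff_succ_X_mul]
    simp only [gS, pS, coeff_mk, gCount_succ hs0 hs, map_sum, coeff_mul]
    push_cast
    rw [Finset.sum_comm]
    congr 1
    refine Finset.sum_congr rfl fun a _ => Finset.sum_congr rfl fun kl _ => ?_
    rw [Finset.mul_sum]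

/-- The alternating expression of the theorem. -/
noncomputable def F (m d s t : ℕ) : PowerSeries ℤ :=
  (if s = t then (-1 : PowerSeries ℤ) ^ t * cS m else 0) +
    ∑ i ∈ Finset.range t, (-1 : PowerSeries ℤ) ^ (t - i + 1) * gS m d (s - t + i) i

theorem F_succ (m d s t : ℕ) (h : t ≤ s) :
    F m d (s + 1) (t + 1) = gS m d s t - F m d s t := by
  unfold F
  rw [Finset.sum_range_succ]
  have e : ∑ i ∈ Finset.range t, (-1 : PowerSeries ℤ) ^ (t + 1 - i + 1) *
      gS m d (s + 1 - (t + 1) + i) i =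
      - ∑ i ∈ Finset.range t, (-1 : PowerSeries ℤ) ^ (t - i + 1) * gS m d (s - t + i) i := by
    rw [← Finset.sum_neg_distrib]
    refine Finset.sum_congr rfl fun i hi => ?_
    have := Finset.mem_range.1 hi
    rw [show t + 1 - i + 1 = (t - i + 1) + 1 by omega, show s + 1 - (t + 1) = s - t by omega]
    ring
  rw [e, show t + 1 - t + 1 = 2 by omega, show s + 1 - (t + 1) + t = s by omega]
  by_cases hst : s = t
  · simp [hst]; ring
  · simp [hst]; ring

theorem pS_eq_F {m d s t : ℕ} (hd : 1 ≤ d) (hts : t ≤ s) (hs : s ≤ d) (hs0 : 0 < s) :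
    pS m d s t = F m d s t := by
  induction t generalizing s with
  | zero =>
    have : s ≠ 0 := by omega
    ext n
    simp [pS, F, this, pF_zero_right]
  | succ t ih =>
    obtain ⟨s, rfl⟩ : ∃ s', s = s' + 1 := ⟨s - 1, by omega⟩
    rw [pS_succ hd hs (by omega), F_succ _ _ _ _ (by omega)]
    split_ifs with h
    · obtain ⟨rfl, rfl⟩ := h
      simp [F]
    · by_cases h0 : s = 0
      · omega
      · rw [ih (by omega) (by omega) (by omega)]

theorem pS_symm {m d s t : ℕ} (hd : 1 ≤ d) (hs : s ≤ d) (ht : t ≤ d) :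
    pS m d s t = pS m d t s := by
  induction s generalizing t with
  | zero =>
    ext n
    simp [pS, pF_zero_right, pF_zero_left]
  | succ s ih =>
    cases t with
    | zero =>
      ext n
      simp [pS, pF_zero_right, pF_zero_left]
    | succ t =>
      rw [pS_succ hd hs ht, pS_succ hd ht hs, gS_symm (by omega) (by omega),
        ih (by omega) (by omega)]
      simp only [and_comm]

theorem pS_eq {m d s a : ℕ} (hd : 1 ≤ d) (hs0 : 0 < s) (hs : s ≤ d) (ha : a ≤ d) :
    pS m d s a = (if s = a then (-1 : PowerSeries ℤ) ^ (min s a) * cS m else 0) +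
      ∑ j ∈ Finset.range (min s a), (-1 : PowerSeries ℤ) ^ (min s a - j + 1) *
        gS m d (max s a - min s a + j) j := by
  rcases le_total a s with h | h
  · rw [pS_eq_F hd h hs hs0, min_eq_right h, max_eq_left h]
    rfl
  · rw [pS_symm hd hs ha, pS_eq_F hd h ha (by omega), min_eq_left h, max_eq_right h]
    simp only [F, eq_comm]

theorem Gps_eq {m d : ℕ} (hd : d ≠ 0) (s t : ℕ) : Gps m d s t = expand d hd (gS m d s t) := by
  ext N
  by_cases h : d ∣ N
  · obtain ⟨n, rfl⟩ := h
    rw [coeff_expand_mul]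
    simp [Gps, gS, gCount_eq, Nat.mul_div_cancel_left n (Nat.pos_of_ne_zero hd)]
  · rw [coeff_expand_of_not_dvd _ _ _ h]
    simp [Gps, h]

theorem Cps_eq {m d : ℕ} (hd : d ≠ 0) : Cps m d = expand d hd (cS m) := by
  simp [Cps, cS, pow_mul]

end DLU

theorem stmt13 (m d : ℕ) (hm : 1 ≤ m) (hd : 1 ≤ d) :
    (Gps m d 0 0 =
      1 + (PowerSeries.X : PowerSeries ℤ) ^ d * ∑ i ∈ Finset.range (d + 1), Gps m d i 0) ∧
    ∀ s t : ℕ, t ≤ d - 1 → 0 < s → s ≤ d → t < s →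
      Gps m d s t =
        (if s = t then (-1 : PowerSeries ℤ) ^ t * Cps m d else 0) +
        (∑ i ∈ Finset.range t, (-1 : PowerSeries ℤ) ^ (t - i + 1) * Gps m d (s - t + i) i) +
        (PowerSeries.X : PowerSeries ℤ) ^ d *
          ∑ a ∈ Finset.Icc 1 d,
            ((if s = a then (-1 : PowerSeries ℤ) ^ (min s a) * Cps m d else 0) +
              ∑ j ∈ Finset.range (min s a),
                (-1 : PowerSeries ℤ) ^ (min s a - j + 1) *
                  Gps m d (max s a - min s a + j) j) *
            ∑ c ∈ Finset.range (d - a + 1), Gps m d c t := by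
  have hd0 : d ≠ 0 := by omega
  refine ⟨?_, ?_⟩
  · simp only [DLU.Gps_eq hd0]
    rw [DLU.g00]
    simp
  · intro s t ht hs0 hs hts
    have h := DLU.gst (m := m) (t := t) hs0 hs
    rw [DLU.pS_eq_F hd hts.le hs hs0] at h
    have h2 : ∀ a ∈ Finset.Icc 1 d, DLU.pS m d s a * ∑ c ∈ Finset.range (d - a + 1), DLU.gS m d c t
        = _ := fun a ha => by
      rw [DLU.pS_eq hd hs0 hs (Finset.mem_Icc.1 ha).2]
    rw [Finset.sum_congr rfl h2, DLU.F] at h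
    simp only [DLU.Gps_eq hd0, DLU.Cps_eq hd0]
    have h3 := congrArg (PowerSeries.expand d hd0) h
    rw [h3]
    simp only [map_add, map_mul, map_sum, map_pow, map_neg, map_one, apply_ite, map_zero,
      PowerSeries.expand_X]
end

section
/- For every integer m ≥ 1, the generating function S_{m,1}(x) = Σ_{n≥0} s_{m,1}(n) xⁿ of m-regular 1-contact (simple) stacks satisfies, as formal power series over ℤ, the quadratic equation (x³ − x²)·S_{m,1}(x)² + (−x^{m+1} + 2x² − 2x + 1)·S_{m,1}(x) + x − 1 = 0; equivalently, x²·S_{m,1}(x)² − (Σ_{l=0}^{m} x^l − 2x)·S_{m,1}(x) + 1 = 0. -/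
/-- Pairwise reformulation of simple stacks. -/
def SimpSt (m n : ℕ) (S : Finset (ℕ × ℕ)) : Prop :=
  (∀ a b, (a, b) ∈ S → 1 ≤ a ∧ a < b ∧ b ≤ n ∧ a + m ≤ b) ∧
  (∀ a b, (a, b) ∈ S → ∀ c d, (c, d) ∈ S → (a = c ∧ b = d) ∨
    (a ≠ c ∧ a ≠ d ∧ b ≠ c ∧ b ≠ d ∧ ¬ (a < c ∧ c < b ∧ b < d)))

theorem isStack_iff (m n : ℕ) (S : Finset (ℕ × ℕ)) : IsStack m 1 n S ↔ SimpSt m n S := by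
  constructor
  · rintro ⟨⟨h1, h2, h3⟩, h4⟩
    refine ⟨fun a b h => ?_, fun a b h c d h' => ?_⟩
    · have := h1 _ h
      have := h4 _ h
      simp only at *
      omega
    · by_cases he : a = c ∧ b = d
      · exact Or.inl he
      · right
        have key : ∀ v, (a = v ∨ b = v) → (c = v ∨ d = v) → False := by
          intro v e1 e2
          have := Finset.card_le_one.1 (h3 v) (a, b) (by simp [h, e1]) (c, d) (by simp [h', e2])
          simp only [Prod.mk.injEq] at this
          exact he this
        refine ⟨?_, ?_, ?_, ?_, h2 _ h _ h'⟩
        · intro e; exact key a (Or.inl rfl) (Or.inl e.symm)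
        · intro e; exact key a (Or.inl rfl) (Or.inr e.symm)
        · intro e; exact key b (Or.inr rfl) (Or.inl e.symm)
        · intro e; exact key b (Or.inr rfl) (Or.inr e.symm)
  · rintro ⟨h1, h2⟩
    refine ⟨⟨?_, ?_, ?_⟩, ?_⟩
    · rintro ⟨a, b⟩ h
      have := h1 a b h
      simp only
      omega
    · rintro ⟨a, b⟩ h ⟨c, d⟩ h'
      have := h2 a b h c d h'
      simp only
      omega
    · intro v
      rw [Finset.card_le_one]
      rintro ⟨a, b⟩ h ⟨c, d⟩ h'
      simp only [Finset.mem_filter] at h h'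
      have := h2 a b h.1 c d h'.1
      simp only [Prod.mk.injEq]
      omega
    · rintro ⟨a, b⟩ h
      have := h1 a b h
      simp only
      omega

open Classical in
/-- The finite set of simple stacks. -/
noncomputable def stk (m n : ℕ) : Finset (Finset (ℕ × ℕ)) :=
  (Finset.range (n + 1) ×ˢ Finset.range (n + 1)).powerset.filter (SimpSt m n)

theorem mem_stk (m n : ℕ) (S : Finset (ℕ × ℕ)) : S ∈ stk m n ↔ SimpSt m n S := by
  classical
  simp only [stk, Finset.mem_filter, Finset.mem_powerset, and_iff_right_iff_imp]
  rintro ⟨h, -⟩ ⟨a, b⟩ hp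
  have := h a b hp
  simp only [Finset.mem_product, Finset.mem_range]
  omega

theorem sCount_eq (m n : ℕ) : sCount m 1 n = (stk m n).card := by
  rw [sCount, ← Set.ncard_coe_finset]
  congr 1
  ext S
  simp [mem_stk, isStack_iff]

/-- Glue stacks `A`, `B` under a new arc `(k, N)`. -/
def glueSt (k N : ℕ) (q : Finset (ℕ × ℕ) × Finset (ℕ × ℕ)) : Finset (ℕ × ℕ) :=
  insert (k, N) (q.1 ∪ q.2.image fun p => (p.1 + k, p.2 + k))

theorem mem_glueSt (k N : ℕ) (A B : Finset (ℕ × ℕ)) (a b : ℕ) :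
    (a, b) ∈ glueSt k N (A, B) ↔
      (a = k ∧ b = N) ∨ (a, b) ∈ A ∨ (k ≤ a ∧ k ≤ b ∧ (a - k, b - k) ∈ B) := by
  simp only [glueSt, Finset.mem_insert, Finset.mem_union, Finset.mem_image, Prod.mk.injEq,
    Prod.exists]
  refine or_congr Iff.rfl (or_congr Iff.rfl ⟨?_, ?_⟩)
  · rintro ⟨c, d, h, rfl, rfl⟩
    simpa using h
  · rintro ⟨h1, h2, h⟩
    exact ⟨_, _, h, by omega, by omega⟩

theorem simpSt_glue {m i j : ℕ} (hj : m ≤ j + 1) {A B : Finset (ℕ × ℕ)}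
    (hA : SimpSt m i A) (hB : SimpSt m j B) :
    SimpSt m (i + j + 2) (glueSt (i + 1) (i + j + 2) (A, B)) := by
  obtain ⟨hA1, hA2⟩ := hA
  obtain ⟨hB1, hB2⟩ := hB
  refine ⟨fun a b h => ?_, fun a b h c d h' => ?_⟩
  · rw [mem_glueSt] at h
    rcases h with h | h | ⟨h1, h2, h⟩
    · omega
    · have := hA1 _ _ h
      omega
    · have := hB1 _ _ h
      omega
  · rw [mem_glueSt] at h h'
    rcases h with h | h | ⟨h1, h2, h⟩ <;> rcases h' with h' | h' | ⟨h1', h2', h'⟩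
    · omega
    · have := hA1 _ _ h'
      omega
    · have := hB1 _ _ h'
      omega
    · have := hA1 _ _ h
      omega
    · exact hA2 _ _ h _ _ h'
    · have := hA1 _ _ h
      have := hB1 _ _ h'
      omega
    · have := hB1 _ _ h
      omega
    · have := hB1 _ _ h
      have := hA1 _ _ h'
      omega
    · have := hB2 _ _ h _ _ h'
      omega

theorem glue_inj {m i j : ℕ} {A B A' B' : Finset (ℕ × ℕ)}
    (hA : SimpSt m i A) (hB : SimpSt m j B) (hA' : SimpSt m i A') (hB' : SimpSt m j B')
    (h : glueSt (i + 1) (i + j + 2) (A, B) = glueSt (i + 1) (i + j + 2) (A', B')) :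
    A = A' ∧ B = B' := by
  have key : ∀ {A B A' B' : Finset (ℕ × ℕ)}, SimpSt m i A → SimpSt m j B → SimpSt m i A' →
      SimpSt m j B' → glueSt (i + 1) (i + j + 2) (A, B) = glueSt (i + 1) (i + j + 2) (A', B') →
      A ⊆ A' ∧ B ⊆ B' := by
    intro A B A' B' hA hB hA' hB' h
    constructor
    · rintro ⟨a, b⟩ hp
      have h1 := hA.1 _ _ hp
      have h2 : (a, b) ∈ glueSt (i + 1) (i + j + 2) (A', B') := by
        rw [← h, mem_glueSt]; exact Or.inr (Or.inl hp)
      rw [mem_glueSt] at h2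
      rcases h2 with h2 | h2 | h2
      · omega
      · exact h2
      · omega
    · rintro ⟨a, b⟩ hp
      have h1 := hB.1 _ _ hp
      have h2 : (a + (i + 1), b + (i + 1)) ∈ glueSt (i + 1) (i + j + 2) (A', B') := by
        rw [← h, mem_glueSt]; exact Or.inr (Or.inr ⟨by omega, by omega, by simpa using hp⟩)
      rw [mem_glueSt] at h2
      rcases h2 with h2 | h2 | h2
      · omega
      · have := hA'.1 _ _ h2
        omega
      · simpa using h2.2.2
  have e1 := key hA hB hA' hB' h
  have e2 := key hA' hB' hA hB h.symm
  exact ⟨e1.1.antisymm e2.1, e1.2.antisymm e2.2⟩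

theorem glue_surj {m i j : ℕ} {S : Finset (ℕ × ℕ)} (hS : SimpSt m (i + j + 2) S)
    (hk : (i + 1, i + j + 2) ∈ S) :
    ∃ A B, SimpSt m i A ∧ SimpSt m j B ∧ glueSt (i + 1) (i + j + 2) (A, B) = S := by
  classical
  obtain ⟨h1, h2⟩ := hS
  let A := S.filter fun p => p.2 ≤ i
  let B := (Finset.range (j + 1) ×ˢ Finset.range (j + 1)).filter fun p =>
    1 ≤ p.1 ∧ (p.1 + (i + 1), p.2 + (i + 1)) ∈ S
  have mA : ∀ a b, (a, b) ∈ A ↔ (a, b) ∈ S ∧ b ≤ i := fun a b => by simp [A]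
  have mB : ∀ a b, (a, b) ∈ B ↔ (a ≤ j ∧ b ≤ j) ∧ 1 ≤ a ∧ (a + (i + 1), b + (i + 1)) ∈ S :=
    fun a b => by simp [B, Nat.lt_succ_iff]
  refine ⟨A, B, ⟨fun a b h => ?_, fun a b h c d h' => ?_⟩,
    ⟨fun a b h => ?_, fun a b h c d h' => ?_⟩, ?_⟩
  · rw [mA] at h
    have := h1 _ _ h.1
    omega
  · rw [mA] at h h'
    exact h2 _ _ h.1 _ _ h'.1
  · rw [mB] at h
    have := h1 _ _ h.2.2
    omega
  · rw [mB] at h h'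
    have := h2 _ _ h.2.2 _ _ h'.2.2
    omega
  · ext ⟨a, b⟩
    rw [mem_glueSt, mA, mB]
    constructor
    · rintro (h | h | ⟨e1, e2, h⟩)
      · rw [h.1, h.2]; exact hk
      · exact h.1
      · have := h.2.2
        rwa [Nat.sub_add_cancel e1, Nat.sub_add_cancel e2] at this
    · intro h
      have a1 := h1 _ _ h
      have a2 := h2 _ _ h _ _ hk
      have a3 := h2 _ _ hk _ _ h
      by_cases c1 : a = i + 1 ∧ b = i + j + 2
      · exact Or.inl c1
      by_cases c2 : b ≤ i
      · exact Or.inr (Or.inl ⟨h, c2⟩)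
      have c3 : i + 1 ≤ a := by omega
      have c4 : i + 1 ≤ b := by omega
      refine Or.inr (Or.inr ⟨c3, c4, ⟨by omega, by omega⟩, by omega, ?_⟩)
      rwa [Nat.sub_add_cancel c3, Nat.sub_add_cancel c4]

theorem card_glue {m i j : ℕ} (hj : m ≤ j + 1) :
    ((stk m (i + j + 2)).filter fun S => (i + 1, i + j + 2) ∈ S).card =
      (stk m i).card * (stk m j).card := by
  rw [← Finset.card_product]
  symm
  refine Finset.card_bij (fun q _ => glueSt (i + 1) (i + j + 2) q) ?_ ?_ ?_
  · rintro ⟨A, B⟩ h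
    simp only [Finset.mem_product, mem_stk] at h
    simp only [Finset.mem_filter, mem_stk]
    exact ⟨simpSt_glue hj h.1 h.2, by rw [mem_glueSt]; simp⟩
  · rintro ⟨A, B⟩ h ⟨A', B'⟩ h' e
    simp only [Finset.mem_product, mem_stk] at h h'
    have := glue_inj h.1 h.2 h'.1 h'.2 e
    simp [this.1, this.2]
  · intro S hS
    simp only [Finset.mem_filter, mem_stk] at hS
    obtain ⟨A, B, hA, hB, e⟩ := glue_surj hS.1 hS.2
    exact ⟨(A, B), by simp [mem_stk, hA, hB], e⟩

theorem card_glue_zero {m i j : ℕ} (hj : ¬ m ≤ j + 1) :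
    ((stk m (i + j + 2)).filter fun S => (i + 1, i + j + 2) ∈ S).card = 0 := by
  rw [Finset.card_eq_zero, Finset.filter_eq_empty_iff]
  intro S hS h
  rw [mem_stk] at hS
  have := hS.1 _ _ h
  omega

theorem stk_rec (m n : ℕ) : (stk m (n + 2)).card = (stk m (n + 1)).card +
    ∑ p ∈ Finset.HasAntidiagonal.antidiagonal n,
      if m ≤ p.2 + 1 then (stk m p.1).card * (stk m p.2).card else 0 := by
  classical
  have e : stk m (n + 2) = stk m (n + 1) ∪ (Finset.HasAntidiagonal.antidiagonal n).biUnion fun p =>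
      (stk m (n + 2)).filter fun S => (p.1 + 1, n + 2) ∈ S := by
    ext S
    simp only [Finset.mem_union, Finset.mem_biUnion, Finset.mem_filter, mem_stk,
      Finset.HasAntidiagonal.mem_antidiagonal, Prod.exists]
    constructor
    · intro h
      by_cases c : ∃ a, (a, n + 2) ∈ S
      · obtain ⟨a, ha⟩ := c
        have := h.1 _ _ ha
        refine Or.inr ⟨a - 1, n + 1 - a, by omega, h, ?_⟩
        rwa [Nat.sub_add_cancel this.1]
      · refine Or.inl ⟨fun a b hab => ?_, h.2⟩
        have := h.1 _ _ hab
        have : b ≠ n + 2 := by rintro rfl; exact c ⟨a, hab⟩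
        omega
    · rintro (h | ⟨_, _, _, h, _⟩)
      · refine ⟨fun a b hab => ?_, h.2⟩
        have := h.1 _ _ hab
        omega
      · exact h
  rw [e, Finset.card_union_of_disjoint, Finset.card_biUnion]
  · congr 1
    refine Finset.sum_congr rfl ?_
    rintro ⟨i, j⟩ hp
    rw [Finset.HasAntidiagonal.mem_antidiagonal] at hp
    simp only at hp
    subst hp
    split_ifs with hj
    · exact card_glue hj
    · exact card_glue_zero hj
  · rintro ⟨i, j⟩ hp ⟨i', j'⟩ hp' hne
    rw [Finset.mem_coe, Finset.HasAntidiagonal.mem_antidiagonal] at hp hp'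
    simp only at hp hp'
    rw [Function.onFun, Finset.disjoint_left]
    intro S hS hS'
    simp only [Finset.mem_filter, mem_stk] at hS hS'
    have := hS.1.2 _ _ hS.2 _ _ hS'.2
    apply hne
    simp only [Prod.mk.injEq]
    omega
  · rw [Finset.disjoint_left]
    intro S hS hS'
    simp only [Finset.mem_biUnion, Finset.mem_filter, mem_stk] at hS hS'
    obtain ⟨p, _, _, h⟩ := hS'
    have := hS.1 _ _ h
    omega

theorem stk_small {m n : ℕ} (h : n ≤ m) (hm : 1 ≤ m) : (stk m n).card = 1 := by
  rw [Finset.card_eq_one]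
  refine ⟨∅, ?_⟩
  ext S
  rw [mem_stk, Finset.mem_singleton]
  constructor
  · intro hS
    rw [Finset.eq_empty_iff_forall_notMem]
    rintro ⟨a, b⟩ hp
    have := hS.1 _ _ hp
    omega
  · rintro rfl
    exact ⟨by simp, by simp⟩

theorem Sps_eq (m : ℕ) (hm : 1 ≤ m) : Sps m 1 = 1 + PowerSeries.X * Sps m 1 +
    PowerSeries.X ^ 2 * (Sps m 1 *
      (Sps m 1 - ∑ l ∈ Finset.range (m - 1), (PowerSeries.X : PowerSeries ℤ) ^ l)) := by
  have hT : Sps m 1 - ∑ l ∈ Finset.range (m - 1), (PowerSeries.X : PowerSeries ℤ) ^ l =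
      PowerSeries.mk fun b => if m ≤ b + 1 then ((stk m b).card : ℤ) else 0 := by
    ext b
    simp only [map_sub, map_sum, Sps, PowerSeries.coeff_mk, PowerSeries.coeff_X_pow,
      Finset.sum_ite_eq, Finset.mem_range, sCount_eq]
    by_cases c : m ≤ b + 1
    · rw [if_neg (by omega), if_pos c, sub_zero]
    · rw [if_pos (by omega), if_neg c, stk_small (by omega) hm]
      simp
  rw [hT]
  ext n
  rcases n with _ | _ | n
  · simp [Sps, sCount_eq, stk_small (Nat.zero_le m) hm]
  · have : PowerSeries.coeff 1 (PowerSeries.X ^ 2 * (Sps m 1 *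
      PowerSeries.mk fun b => if m ≤ b + 1 then ((stk m b).card : ℤ) else 0)) = 0 := by
      rw [PowerSeries.coeff_X_pow_mul']; simp
    rw [map_add, map_add, zero_add, this, ← zero_add 1, PowerSeries.coeff_succ_X_mul]
    simp [Sps, sCount_eq, stk_small (Nat.zero_le m) hm, stk_small hm hm, PowerSeries.coeff_one]
  · rw [map_add, map_add, PowerSeries.coeff_succ_X_mul,
      show n + 1 + 1 = n + 2 from rfl, PowerSeries.coeff_X_pow_mul,
      PowerSeries.coeff_mul]
    simp only [Sps, PowerSeries.coeff_mk, sCount_eq, stk_rec m n, PowerSeries.coeff_one]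
    push_cast
    simp

theorem stmt14 (m : ℕ) (hm : 1 ≤ m) :
    (((PowerSeries.X : PowerSeries ℤ) ^ 3 - (PowerSeries.X : PowerSeries ℤ) ^ 2) *
        (Sps m 1) ^ 2 +
      (-((PowerSeries.X : PowerSeries ℤ) ^ (m + 1)) + 2 * (PowerSeries.X : PowerSeries ℤ) ^ 2 -
        2 * (PowerSeries.X : PowerSeries ℤ) + 1) * Sps m 1 +
      (PowerSeries.X : PowerSeries ℤ) - 1 = 0) ∧
    ((PowerSeries.X : PowerSeries ℤ) ^ 2 * (Sps m 1) ^ 2 -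
      ((∑ l ∈ Finset.range (m + 1), (PowerSeries.X : PowerSeries ℤ) ^ l) -
        2 * (PowerSeries.X : PowerSeries ℤ)) * Sps m 1 + 1 = 0) := by
  have h := Sps_eq m hm
  obtain ⟨k, rfl⟩ : ∃ k, m = k + 1 := ⟨m - 1, by omega⟩
  have hs : (∑ l ∈ Finset.range (k + 1 + 1), (PowerSeries.X : PowerSeries ℤ) ^ l) =
      1 + PowerSeries.X + PowerSeries.X ^ 2 *
        ∑ l ∈ Finset.range k, (PowerSeries.X : PowerSeries ℤ) ^ l := by
    rw [Finset.sum_range_succ', Finset.sum_range_succ', Finset.mul_sum]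
    simp only [pow_add]
    rw [Finset.sum_congr rfl fun l _ => show (PowerSeries.X : PowerSeries ℤ) ^ l *
      PowerSeries.X ^ 1 * PowerSeries.X ^ 1 = PowerSeries.X ^ 2 * PowerSeries.X ^ l by ring]
    ring
  have hg := geom_sum_mul (PowerSeries.X : PowerSeries ℤ) (k + 1 + 1)
  rw [Nat.add_sub_cancel] at h
  have h2 : (PowerSeries.X : PowerSeries ℤ) ^ 2 * (Sps (k + 1) 1) ^ 2 -
      ((∑ l ∈ Finset.range (k + 1 + 1), (PowerSeries.X : PowerSeries ℤ) ^ l) -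
        2 * (PowerSeries.X : PowerSeries ℤ)) * Sps (k + 1) 1 + 1 = 0 := by
    rw [hs]
    linear_combination -h
  refine ⟨?_, h2⟩
  linear_combination (PowerSeries.X - 1) * h2 + Sps (k + 1) 1 * hg
end
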